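/- arXiv:1203.5952 — 2 statements merged into one kernel-verified Lean document; each statement's English description precedes it below -/
import Mathlib

section
/- If a stable system Ŝ (of any order n̂, with m inputs and p outputs) satisfies ∫_ℝ ‖G(iω) − G_{Ŝ}(iω)‖_F² dω = ∫_ℝ ‖G_{S₋}(iω)‖_F² dω (extended-real-valued Lebesgue integrals; the right-hand side is finite), then G_{Ŝ}(iω) = G_{S₊}(iω) for all ω ∈ ℝ; i.e. the optimal RH₂-approximation is unique in the sense that every optimal solution is a realization of G_{S₊}. -/
open Matrix

noncomputable section

/-- Entrywise complexification of a real matrix. -/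
def cplx {ι κ : Type*} (M : Matrix ι κ ℝ) : Matrix ι κ ℂ :=
  M.map fun x => (x : ℂ)

/-- The matrix pair (E, A) is regular: det(sE − A) ≠ 0 for some s ∈ ℂ. -/
def RegularPair {ι : Type*} [Fintype ι] [DecidableEq ι] (E A : Matrix ι ι ℝ) : Prop :=
  ∃ s : ℂ, (s • cplx E - cplx A).det ≠ 0

/-- (E, A) is stable: sE − A is invertible for every s with Re s ≥ 0. -/
def StablePair {ι : Type*} [Fintype ι] [DecidableEq ι] (E A : Matrix ι ι ℝ) : Prop :=
  ∀ s : ℂ, 0 ≤ s.re → IsUnit (s • cplx E - cplx A)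

/-- (E, A) is antistable: E invertible and sE − A invertible for every s with Re s ≤ 0. -/
def AntistablePair {ι : Type*} [Fintype ι] [DecidableEq ι] (E A : Matrix ι ι ℝ) : Prop :=
  IsUnit E ∧ ∀ s : ℂ, s.re ≤ 0 → IsUnit (s • cplx E - cplx A)

/-- Transfer function G(s) = C (sE − A)⁻¹ B + D of the system (E, A, B, C, D). -/
def transfer {ι κm κp : Type*} [Fintype ι] [DecidableEq ι]
    (E A : Matrix ι ι ℝ) (B : Matrix ι κm ℝ) (C : Matrix κp ι ℝ) (D : Matrix κp κm ℝ)
    (s : ℂ) : Matrix κp κm ℂ :=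
  cplx C * (s • cplx E - cplx A)⁻¹ * cplx B + cplx D

/-- Spectral norm (ℓ² operator norm) of a complex matrix. -/
def spec2 {κp κm : Type*} [Fintype κp] [Fintype κm] [DecidableEq κm]
    (M : Matrix κp κm ℂ) : ℝ :=
  ‖LinearMap.toContinuousLinearMap (Matrix.toEuclideanLin M)‖

/-- Squared Frobenius norm of a complex matrix. -/
def frobSq {κp κm : Type*} [Fintype κp] [Fintype κm] (M : Matrix κp κm ℂ) : ℝ :=
  ∑ i, ∑ j, ‖M i j‖ ^ 2

/-- `Xc`, `Xo` are controllability/observability Gramians of the system (E, A, B, C, ·). -/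
def IsGramians {ι κm κp : Type*} [Fintype ι] [Fintype κm] [Fintype κp]
    (E A : Matrix ι ι ℝ) (B : Matrix ι κm ℝ) (C : Matrix κp ι ℝ)
    (Xc Xo : Matrix ι ι ℝ) : Prop :=
  Xc.IsSymm ∧ Xo.IsSymm ∧
    A * Xc * Eᵀ + E * Xc * Aᵀ + B * Bᵀ = 0 ∧
    Aᵀ * Xo * E + Eᵀ * Xo * A + Cᵀ * C = 0

/-- σ₁ ≥ 0 is the largest Hankel singular value: σ₁² is the greatest eigenvalue of XcEᵀXoE. -/
def IsLargestHSV {ι : Type*} [Fintype ι] [DecidableEq ι]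
    (E Xc Xo : Matrix ι ι ℝ) (σ1 : ℝ) : Prop :=
  0 ≤ σ1 ∧ ((σ1 : ℂ) ^ 2) ∈ spectrum ℂ (cplx (Xc * Eᵀ * Xo * E)) ∧
    ∀ μ ∈ spectrum ℂ (cplx (Xc * Eᵀ * Xo * E)), μ.re ≤ σ1 ^ 2

/-- R_γ = XoEXcEᵀ − γ²I. -/
def Rg {ι : Type*} [Fintype ι] [DecidableEq ι] (E Xc Xo : Matrix ι ι ℝ) (γ : ℝ) :
    Matrix ι ι ℝ :=
  Xo * E * Xc * Eᵀ - γ ^ 2 • (1 : Matrix ι ι ℝ)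

/-- E_γ = Eᵀ R_γ. -/
def Eg {ι : Type*} [Fintype ι] [DecidableEq ι] (E Xc Xo : Matrix ι ι ℝ) (γ : ℝ) :
    Matrix ι ι ℝ :=
  Eᵀ * Rg E Xc Xo γ

/-- C_γ = C Xc Eᵀ. -/
def Cg {ι κp : Type*} [Fintype ι] (C : Matrix κp ι ℝ) (E Xc : Matrix ι ι ℝ) :
    Matrix κp ι ℝ :=
  C * Xc * Eᵀ

/-- A_γ = −Aᵀ R_γ − Cᵀ C_γ. -/
def Ag {ι κp : Type*} [Fintype ι] [Fintype κp] [DecidableEq ι]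
    (E A : Matrix ι ι ℝ) (C : Matrix κp ι ℝ) (Xc Xo : Matrix ι ι ℝ) (γ : ℝ) :
    Matrix ι ι ℝ :=
  -(Aᵀ * Rg E Xc Xo γ) - Cᵀ * Cg C E Xc

/-- B_γ = Eᵀ Xo B. -/
def Bg {ι κm : Type*} [Fintype ι] (E Xo : Matrix ι ι ℝ) (B : Matrix ι κm ℝ) :
    Matrix ι κm ℝ :=
  Eᵀ * Xo * B

/-- The point iω on the imaginary axis. -/
def iax (ω : ℝ) : ℂ := (ω : ℂ) * Complex.I

/-- Canonical equivalence Fin k ⊕ Fin d ≃ Fin n given k + d = n. -/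
def finBlockEquiv {k d n : ℕ} (h : k + d = n) : Fin k ⊕ Fin d ≃ Fin n :=
  finSumFinEquiv.trans (finCongr h)

end

noncomputable section

open Polynomial MeasureTheory Filter Topology Asymptotics Bornology

theorem tendsto_iax_cobounded : Tendsto iax (cobounded ℝ) (cobounded ℂ) := by
  rw [← tendsto_norm_atTop_iff_cobounded]
  have h : ∀ ω : ℝ, ‖iax ω‖ = ‖ω‖ := fun ω => by simp [iax]
  simpa only [h] using tendsto_norm_cobounded_atTop (E := ℝ)

theorem continuous_iax : Continuous iax := by
  unfold iax; fun_prop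

theorem iax_re (ω : ℝ) : (iax ω).re = 0 := by simp [iax]

/-- A rational function that is square-integrable on the imaginary axis is strictly proper. -/
theorem degree_X_mul_le_of_integrable_sq {P q : ℂ[X]} (hq : ∀ s : ℂ, s.re = 0 → q.eval s ≠ 0)
    (h : Integrable fun ω : ℝ => ‖P.eval (iax ω) / q.eval (iax ω)‖ ^ 2) :
    (X * P).degree ≤ q.degree := by
  by_contra! hlt
  have hP : P ≠ 0 := by rintro rfl; simp at hlt
  have hle : q.degree ≤ P.degree := by
    have hq0 : q ≠ 0 := by rintro rfl; exact hq 0 rfl (by simp)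
    have h1 := natDegree_lt_natDegree hq0 hlt
    rw [natDegree_X_mul hP] at h1
    rw [degree_eq_natDegree hq0, degree_eq_natDegree hP]
    exact_mod_cast Nat.lt_succ_iff.mp h1
  obtain ⟨c, hc, hO⟩ := (isBigO_cobounded_of_degree_le hle).exists_pos
  have hev : ∀ᶠ ω : ℝ in atTop, (c⁻¹) ^ 2 ≤ ‖P.eval (iax ω) / q.eval (iax ω)‖ ^ 2 := by
    have h1 : Tendsto iax atTop (cobounded ℂ) :=
      tendsto_iax_cobounded.mono_left (by rw [IsOrderBornology.cobounded_eq]; exact le_sup_right)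
    filter_upwards [h1.eventually hO.bound] with ω hω
    have hqω : 0 < ‖q.eval (iax ω)‖ := norm_pos_iff.mpr (hq _ (iax_re ω))
    gcongr
    rw [norm_div, le_div_iff₀ hqω, inv_mul_le_iff₀ hc]
    exact hω
  obtain ⟨a, ha⟩ := eventually_atTop.mp hev
  have hconst : IntegrableOn (fun _ : ℝ => (c⁻¹) ^ 2) (Set.Ici a) := by
    refine h.integrableOn.mono' (by fun_prop) ?_
    filter_upwards [ae_restrict_mem measurableSet_Ici] with ω hω
    rw [Real.norm_of_nonneg (by positivity)]
    exact ha ω hω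
  rw [integrableOn_const_iff] at hconst
  rcases hconst with h0 | h0
  · have : (c⁻¹) ^ 2 ≠ 0 := by positivity
    exact this (by simpa using h0)
  · simp at h0

/-- Cauchy's theorem for the right half-plane: a rational function without poles in the closed
right half-plane which is `O(s⁻²)` at infinity has zero integral along the imaginary axis. -/
theorem integral_iax_eq_zero {N M : ℂ[X]} (hM : ∀ s : ℂ, 0 ≤ s.re → M.eval s ≠ 0)
    (hdeg : (X ^ 2 * N).degree ≤ M.degree)
    (hint : Integrable fun ω : ℝ => N.eval (iax ω) / M.eval (iax ω)) :
    ∫ ω : ℝ, N.eval (iax ω) / M.eval (iax ω) = 0 := by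
  set f : ℂ → ℂ := fun s => N.eval s / M.eval s with hf
  obtain ⟨c, hc, hO⟩ := (isBigO_cobounded_of_degree_le hdeg).exists_pos
  obtain ⟨R₀, -, hR₀⟩ := ((hasBasis_cobounded_norm (E := ℂ)).eventually_iff).mp hO.bound
  have hbound : ∀ R : ℝ, 0 < R → R₀ ≤ R → ∀ s : ℂ, 0 ≤ s.re → R ≤ ‖s‖ → ‖f s‖ ≤ c / R ^ 2 := by
    intro R hR hRR s hs hsR
    have h1 := hR₀ (show s ∈ {x : ℂ | R₀ ≤ ‖x‖} from hRR.trans hsR)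
    have hMs : 0 < ‖M.eval s‖ := norm_pos_iff.mpr (hM s hs)
    simp only [eval_mul, eval_pow, eval_X, norm_mul, norm_pow] at h1
    simp only [hf, norm_div]
    rw [div_le_div_iff₀ hMs (by positivity)]
    calc ‖N.eval s‖ * R ^ 2 ≤ ‖s‖ ^ 2 * ‖N.eval s‖ := by
          rw [mul_comm]; gcongr
      _ ≤ _ := h1
  have hlim : Tendsto (fun R : ℝ => ∫ y in (-R)..R, f (iax y)) atTop (𝓝 (∫ y, f (iax y))) :=
    intervalIntegral_tendsto_integral hint tendsto_neg_atTop_atBot tendsto_id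
  refine tendsto_nhds_unique hlim ?_
  have hsmall : ∀ᶠ R : ℝ in atTop, ‖∫ y in (-R)..R, f (iax y)‖ ≤ 4 * c / R := by
    filter_upwards [eventually_gt_atTop 0, eventually_ge_atTop R₀] with R hR hRR
    have hcauchy := Complex.integral_boundary_rect_eq_zero_of_differentiableOn f
      (-R * Complex.I) (R + R * Complex.I) (by
        intro s hs
        have hs' : 0 ≤ s.re := by
          have := hs.1
          simp [Set.uIcc_of_le hR.le] at this
          exact this.1
        exact ((N.differentiable s).div (M.differentiable s) (hM s hs')).differentiableWithinAt)
    simp only [Complex.add_re, Complex.mul_re, Complex.neg_re, Complex.neg_im, Complex.ofReal_re,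
      Complex.ofReal_im, Complex.I_re, Complex.I_im, Complex.add_im, Complex.mul_im, mul_zero,
      mul_one, neg_zero, sub_zero, add_zero, zero_add,
      Complex.ofReal_zero] at hcauchy
    have e1 : ‖∫ x in (0 : ℝ)..R, f (x + ((-R : ℝ) : ℂ) * Complex.I)‖ ≤ c / R ^ 2 * |R - 0| := by
      refine intervalIntegral.norm_integral_le_of_norm_le_const fun x hx => ?_
      rw [Set.uIoc_of_le hR.le] at hx
      refine hbound R hR hRR _ (by simpa using hx.1.le) ?_
      refine le_trans ?_ (Complex.abs_im_le_norm _)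
      simp [abs_of_pos hR]
    have e2 : ‖∫ x in (0 : ℝ)..R, f (x + (R : ℂ) * Complex.I)‖ ≤ c / R ^ 2 * |R - 0| := by
      refine intervalIntegral.norm_integral_le_of_norm_le_const fun x hx => ?_
      rw [Set.uIoc_of_le hR.le] at hx
      refine hbound R hR hRR _ (by simpa using hx.1.le) ?_
      refine le_trans ?_ (Complex.abs_im_le_norm _)
      simp [abs_of_pos hR]
    have e3 : ‖∫ y in (-R)..R, f ((R : ℂ) + y * Complex.I)‖ ≤ c / R ^ 2 * |R - -R| := by
      refine intervalIntegral.norm_integral_le_of_norm_le_const fun x hx => ?_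
      refine hbound R hR hRR _ (by simpa using hR.le) ?_
      refine le_trans ?_ (Complex.abs_re_le_norm _)
      simp [abs_of_pos hR]
    rw [sub_eq_zero] at hcauchy
    have hI : ‖∫ y in (-R)..R, f (iax y)‖ = ‖Complex.I • ∫ y in (-R)..R, f (iax y)‖ := by
      simp
    rw [hI]
    have heq : Complex.I • ∫ y in (-R)..R, f (iax y) =
        (∫ x in (0 : ℝ)..R, f (x + ((-R : ℝ) : ℂ) * Complex.I)) -
          (∫ x in (0 : ℝ)..R, f (x + (R : ℂ) * Complex.I)) +
        Complex.I • ∫ y in (-R)..R, f ((R : ℂ) + y * Complex.I) := by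
      rw [hcauchy]; simp [iax]
    rw [heq]
    refine (norm_add_le _ _).trans ?_
    refine (add_le_add (norm_sub_le _ _) le_rfl).trans ?_
    rw [norm_smul, Complex.norm_I, one_mul]
    refine (add_le_add (add_le_add e1 e2) e3).trans (le_of_eq ?_)
    rw [sub_zero, sub_neg_eq_add, abs_of_pos hR, abs_of_pos (by linarith : 0 < R + R)]
    field_simp
    ring
  exact squeeze_zero_norm' hsmall (tendsto_const_nhds.div_atTop tendsto_id)

theorem continuous_eval_div_iax {P q : ℂ[X]} (hq : ∀ s : ℂ, s.re = 0 → q.eval s ≠ 0) :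
    Continuous fun ω : ℝ => P.eval (iax ω) / q.eval (iax ω) :=
  (P.continuous.comp continuous_iax).div (q.continuous.comp continuous_iax)
    fun ω => hq _ (iax_re ω)

/-- `h` agrees on the imaginary axis with a rational function whose poles avoid the set `U`. -/
def RationalOffPoles (U : Set ℂ) (h : ℝ → ℂ) : Prop :=
  ∃ P q : ℝ[X], (∀ s ∈ U, aeval s q ≠ 0) ∧ ∀ ω, h ω = aeval (iax ω) P / aeval (iax ω) q

theorem RationalOffPoles.sub {U : Set ℂ} (hU : ∀ ω, iax ω ∈ U) {f g : ℝ → ℂ}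
    (hf : RationalOffPoles U f)
    (hg : RationalOffPoles U g) : RationalOffPoles U fun ω => f ω - g ω := by
  obtain ⟨P, q, hq, hf⟩ := hf
  obtain ⟨R, r, hr, hg⟩ := hg
  refine ⟨P * r - q * R, q * r, fun s hs => by simp [hq s hs, hr s hs], fun ω => ?_⟩
  simp only [hf, hg]
  rw [div_sub_div _ _ (hq _ (hU ω)) (hr _ (hU ω))]
  simp

theorem RationalOffPoles.continuous {U : Set ℂ} (hU : ∀ s : ℂ, s.re = 0 → s ∈ U) {f : ℝ → ℂ}
    (hf : RationalOffPoles U f) : Continuous f := by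
  obtain ⟨P, q, hq, hf⟩ := hf
  rw [funext hf]
  simp only [aeval_def, eval₂_eq_eval_map] at hq ⊢
  exact continuous_eval_div_iax fun s hs => hq s (hU s hs)

/-- Every entry of a transfer function is rational, with poles only where `sE - A` is singular. -/
theorem rationalOffPoles_transfer {ι κm κp : Type*} [Fintype ι] [DecidableEq ι]
    {U : Set ℂ} (hU : ∀ ω, iax ω ∈ U)
    (E A : Matrix ι ι ℝ) (B : Matrix ι κm ℝ) (C : Matrix κp ι ℝ) (D : Matrix κp κm ℝ)
    (h : ∀ s ∈ U, IsUnit (s • cplx E - cplx A)) (i : κp) (j : κm) :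
    RationalOffPoles U fun ω => transfer E A B C D (iax ω) i j := by
  set L : Matrix ι ι ℝ[X] := (X : ℝ[X]) • E.map Polynomial.C - A.map Polynomial.C with hL
  have hmap : ∀ s : ℂ, L.map (aeval s) = s • cplx E - cplx A := by
    intro s
    ext a b
    simp [hL, cplx]
    exact mul_comm _ _
  have hdet : ∀ s : ℂ, aeval s L.det = (s • cplx E - cplx A).det := by
    intro s
    rw [AlgHom.map_det, ← hmap]
    rfl
  have hadj : ∀ (s : ℂ) a b, aeval s (L.adjugate a b) = (s • cplx E - cplx A).adjugate a b := by
    intro s a b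
    rw [← hmap, ← AlgHom.mapMatrix_apply, ← AlgHom.map_adjugate]
    rfl
  have hne : ∀ s ∈ U, aeval s L.det ≠ 0 := by
    intro s hs
    rw [hdet]
    exact ((Matrix.isUnit_iff_isUnit_det _).mp (h s hs)).ne_zero
  refine ⟨(C.map Polynomial.C * L.adjugate * B.map Polynomial.C) i j + Polynomial.C (D i j) * L.det,
    L.det, hne, fun ω => ?_⟩
  rw [eq_div_iff (hne _ (hU ω))]
  have hd := hne _ (hU ω)
  simp only [transfer, Matrix.inv_def, ← hdet, Ring.inverse_eq_inv', Matrix.mul_smul, Matrix.smul_mul, Matrix.add_apply, Matrix.smul_apply, smul_eq_mul,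
    add_mul, map_add, map_mul]
  congr 1
  · rw [mul_right_comm, inv_mul_cancel₀ hd, one_mul]
    simp [Matrix.mul_apply, hadj, cplx]
  · simp [cplx]

/-- Orthogonality of the two Hardy spaces, for rational functions: Pythagoras' identity. -/
theorem integral_norm_add_sq_of_rational {h g : ℝ → ℂ}
    (hh : RationalOffPoles {s | 0 ≤ s.re} h) (hg : RationalOffPoles {s | s.re ≤ 0} g)
    (hadd : Integrable fun ω => ‖h ω + g ω‖ ^ 2) (hgi : Integrable fun ω => ‖g ω‖ ^ 2) :
    Integrable (fun ω => ‖h ω‖ ^ 2) ∧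
      ∫ ω, ‖h ω + g ω‖ ^ 2 = (∫ ω, ‖h ω‖ ^ 2) + ∫ ω, ‖g ω‖ ^ 2 := by
  have hhc : Continuous h := hh.continuous fun s hs => hs.ge
  have hgc : Continuous g := hg.continuous fun s hs => hs.le
  have hhi : Integrable fun ω => ‖h ω‖ ^ 2 := by
    refine ((hadd.const_mul 2).add (hgi.const_mul 2)).mono' (by fun_prop) (.of_forall fun ω => ?_)
    rw [Real.norm_of_nonneg (by positivity)]
    have h1 : ‖h ω‖ ≤ ‖h ω + g ω‖ + ‖g ω‖ := by
      simpa using norm_sub_le (h ω + g ω) (g ω)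
    have h2 : ‖h ω‖ ^ 2 ≤ (‖h ω + g ω‖ + ‖g ω‖) ^ 2 := by gcongr
    simp only [Pi.add_apply]
    nlinarith [sq_nonneg (‖h ω + g ω‖ - ‖g ω‖)]
  refine ⟨hhi, ?_⟩
  set k : ℝ → ℂ := fun ω => h ω * (starRingEnd ℂ) (g ω) with hk
  have hki : Integrable k := by
    refine (hhi.add hgi).mono' (by fun_prop) (.of_forall fun ω => ?_)
    simp only [hk, norm_mul, RCLike.norm_conj, Pi.add_apply]
    nlinarith [sq_nonneg (‖h ω‖ - ‖g ω‖), sq_nonneg ‖h ω‖, sq_nonneg ‖g ω‖]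
  have hk0 : ∫ ω, k ω = 0 := by
    obtain ⟨P, q, hq, hhe⟩ := hh
    obtain ⟨R, r, hr, hge⟩ := hg
    set toC : ℝ[X] → ℂ[X] := Polynomial.map (algebraMap ℝ ℂ) with htoC
    have hev : ∀ (p : ℝ[X]) (s : ℂ), (toC p).eval s = aeval s p := fun p s => by
      rw [htoC, eval_map, aeval_def]
    have hneg : ∀ (p : ℝ[X]) (s : ℂ), ((toC p).comp (-X)).eval s = aeval (-s) p := fun p s => by
      simp [hev]
    have hconj : ∀ ω, (starRingEnd ℂ) (iax ω) = -iax ω := fun ω => by simp [iax]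
    have hgconj : ∀ ω, (starRingEnd ℂ) (g ω) =
        ((toC R).comp (-X)).eval (iax ω) / ((toC r).comp (-X)).eval (iax ω) := fun ω => by
      rw [hge, map_div₀, hneg, hneg, ← aeval_conj, ← aeval_conj, hconj]
    have hq' : ∀ s : ℂ, 0 ≤ s.re → (toC q).eval s ≠ 0 := fun s hs => by
      rw [hev]; exact hq s hs
    have hr' : ∀ s : ℂ, 0 ≤ s.re → ((toC r).comp (-X)).eval s ≠ 0 := fun s hs => by
      rw [hneg]; exact hr (-s) (by simpa using hs)
    have hdP := degree_X_mul_le_of_integrable_sq (P := toC P) (fun s hs => hq' s hs.ge)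
      (by simpa only [hev, ← hhe] using hhi)
    have hdR := degree_X_mul_le_of_integrable_sq (P := (toC R).comp (-X))
      (fun s hs => hr' s hs.ge) (by simpa only [← hgconj, RCLike.norm_conj] using hgi)
    have hkeq : k = fun ω => (toC P * (toC R).comp (-X)).eval (iax ω) /
        (toC q * (toC r).comp (-X)).eval (iax ω) := by
      funext ω
      simp only [hk, hgconj, eval_mul]
      rw [hhe, hev, hev, div_mul_div_comm]
    rw [hkeq] at hki ⊢
    refine integral_iax_eq_zero (fun s hs => ?_) ?_ hki
    · rw [eval_mul]
      exact mul_ne_zero (hq' s hs) (hr' s hs)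
    · rw [show X ^ 2 * (toC P * (toC R).comp (-X)) = (X * toC P) * (X * (toC R).comp (-X)) by ring,
        degree_mul, degree_mul (p := toC q)]
      exact add_le_add hdP hdR
  have hre : ∫ ω, (k ω).re = 0 := by
    have := integral_re hki
    simp only [RCLike.re_to_complex] at this
    rw [this, hk0, Complex.zero_re]
  have hsplit : (fun ω => ‖h ω + g ω‖ ^ 2) =
      fun ω => (‖h ω‖ ^ 2 + ‖g ω‖ ^ 2) + 2 * (k ω).re := by
    funext ω
    simp only [hk, ← Complex.normSq_eq_norm_sq, Complex.normSq_add]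
  have hkre : Integrable fun ω => (k ω).re := hki.re
  have hsum : Integrable fun ω => ‖h ω‖ ^ 2 + ‖g ω‖ ^ 2 := hhi.add hgi
  rw [hsplit, integral_add hsum (hkre.const_mul 2), integral_add hhi hgi,
    integral_const_mul, hre, mul_zero, add_zero]

theorem frobSq_nonneg {κp κm : Type*} [Fintype κp] [Fintype κm] (M : Matrix κp κm ℂ) :
    0 ≤ frobSq M := by
  unfold frobSq; positivity

theorem norm_sq_apply_le_frobSq {κp κm : Type*} [Fintype κp] [Fintype κm] (M : Matrix κp κm ℂ)
    (i : κp) (j : κm) : ‖M i j‖ ^ 2 ≤ frobSq M :=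
  (Finset.single_le_sum (f := fun j => ‖M i j‖ ^ 2) (fun _ _ => by positivity)
    (Finset.mem_univ j)).trans
  (Finset.single_le_sum (f := fun i => ∑ j, ‖M i j‖ ^ 2) (fun _ _ => by positivity)
    (Finset.mem_univ i))

theorem continuous_frobSq {κp κm : Type*} [Fintype κp] [Fintype κm] {F : ℝ → Matrix κp κm ℂ}
    (hF : ∀ i j, Continuous fun ω => F ω i j) : Continuous fun ω => frobSq (F ω) := by
  unfold frobSq
  exact continuous_finsetSum _ fun i _ => continuous_finsetSum _ fun j _ => ((hF i j).norm.pow 2)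

theorem integrable_frobSq {κp κm : Type*} [Fintype κp] [Fintype κm] {F : ℝ → Matrix κp κm ℂ}
    (hF : ∀ i j, Continuous fun ω => F ω i j)
    (hfin : ∫⁻ ω, ENNReal.ofReal (frobSq (F ω)) ≠ ⊤) : Integrable fun ω => frobSq (F ω) :=
  (lintegral_ofReal_ne_top_iff_integrable (continuous_frobSq hF).aestronglyMeasurable
    (.of_forall fun _ => frobSq_nonneg _)).mp hfin

theorem integrable_norm_sq_apply {κp κm : Type*} [Fintype κp] [Fintype κm]
    {F : ℝ → Matrix κp κm ℂ} (hF : ∀ i j, Continuous fun ω => F ω i j)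
    (h : Integrable fun ω => frobSq (F ω)) (i : κp) (j : κm) :
    Integrable fun ω => ‖F ω i j‖ ^ 2 := by
  refine h.mono' ((hF i j).norm.pow 2).aestronglyMeasurable (.of_forall fun ω => ?_)
  rw [Real.norm_of_nonneg (by positivity)]
  exact norm_sq_apply_le_frobSq _ i j

theorem integral_frobSq {κp κm : Type*} [Fintype κp] [Fintype κm] {F : ℝ → Matrix κp κm ℂ}
    (h : ∀ i j, Integrable fun ω => ‖F ω i j‖ ^ 2) :
    ∫ ω, frobSq (F ω) = ∑ i, ∑ j, ∫ ω, ‖F ω i j‖ ^ 2 := by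
  unfold frobSq
  rw [integral_finsetSum _ fun i _ => integrable_finsetSum _ fun j _ => h i j]
  exact Finset.sum_congr rfl fun i _ => integral_finsetSum _ fun j _ => h i j

/-- If `H` is rational and stable, `G` is rational and antistable, and `H + G` has the same finite
`L²` norm as `G` on the imaginary axis, then `H = 0`. -/
theorem eq_zero_of_lintegral_frobSq_add_eq {κp κm : Type*} [Fintype κp] [Fintype κm]
    {H G : ℝ → Matrix κp κm ℂ}
    (hH : ∀ i j, RationalOffPoles {s | 0 ≤ s.re} fun ω => H ω i j)
    (hG : ∀ i j, RationalOffPoles {s | s.re ≤ 0} fun ω => G ω i j)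
    (hfin : ∫⁻ ω, ENNReal.ofReal (frobSq (G ω)) ≠ ⊤)
    (heq : ∫⁻ ω, ENNReal.ofReal (frobSq (H ω + G ω)) = ∫⁻ ω, ENNReal.ofReal (frobSq (G ω)))
    (ω : ℝ) : H ω = 0 := by
  have hHc : ∀ i j, Continuous fun ω => H ω i j := fun i j => (hH i j).continuous fun s hs => hs.ge
  have hGc : ∀ i j, Continuous fun ω => G ω i j := fun i j => (hG i j).continuous fun s hs => hs.le
  have hSc : ∀ i j, Continuous fun ω => (H ω + G ω) i j := fun i j => (hHc i j).add (hGc i j)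
  have hGF := integrable_frobSq hGc hfin
  have hSF := integrable_frobSq hSc (heq ▸ hfin)
  have hGi := integrable_norm_sq_apply hGc hGF
  have hSi := integrable_norm_sq_apply hSc hSF
  have hpyth := fun i j => integral_norm_add_sq_of_rational (hH i j) (hG i j) (hSi i j) (hGi i j)
  have hint : ∫ ω, frobSq (H ω + G ω) = ∫ ω, frobSq (G ω) := by
    rw [integral_eq_lintegral_of_nonneg_ae (.of_forall fun _ => frobSq_nonneg _)
        hSF.aestronglyMeasurable, heq,
      ← integral_eq_lintegral_of_nonneg_ae (.of_forall fun _ => frobSq_nonneg _)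
        hGF.aestronglyMeasurable]
  rw [integral_frobSq hSi, integral_frobSq hGi] at hint
  simp only [Matrix.add_apply, (hpyth _ _).2, Finset.sum_add_distrib] at hint
  have hnn : ∀ i j, 0 ≤ ∫ ω, ‖H ω i j‖ ^ 2 := fun i j => integral_nonneg fun _ => by positivity
  have hzero : ∑ i, ∑ j, ∫ ω, ‖H ω i j‖ ^ 2 = 0 := by linarith
  ext i j
  have hij : ∫ ω, ‖H ω i j‖ ^ 2 = 0 := by
    rw [Finset.sum_eq_zero_iff_of_nonneg fun i _ => Finset.sum_nonneg fun j _ => hnn i j] at hzero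
    have := hzero i (Finset.mem_univ i)
    rw [Finset.sum_eq_zero_iff_of_nonneg fun j _ => hnn i j] at this
    exact this j (Finset.mem_univ j)
  rw [integral_eq_zero_iff_of_nonneg (fun _ => by positivity) (hpyth i j).1] at hij
  have hfun : (fun ω => ‖H ω i j‖ ^ 2) = fun _ => (0 : ℝ) :=
    (Continuous.ae_eq_iff_eq volume ((hHc i j).norm.pow 2) continuous_const).mp hij
  simpa using congrFun hfun ω

theorem stmt7 {np nm m p : ℕ}
    (Ep Ap : Matrix (Fin np) (Fin np) ℝ) (Bp : Matrix (Fin np) (Fin m) ℝ)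
    (Cp : Matrix (Fin p) (Fin np) ℝ) (D : Matrix (Fin p) (Fin m) ℝ)
    (Em Am : Matrix (Fin nm) (Fin nm) ℝ) (Bm : Matrix (Fin nm) (Fin m) ℝ)
    (Cm : Matrix (Fin p) (Fin nm) ℝ)
    (hp : StablePair Ep Ap) (hm : AntistablePair Em Am)
    (hfin : ∫⁻ ω : ℝ, ENNReal.ofReal (frobSq (transfer Em Am Bm Cm 0 (iax ω))) ≠ ⊤)
    {n' : ℕ} (E' A' : Matrix (Fin n') (Fin n') ℝ) (B' : Matrix (Fin n') (Fin m) ℝ)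
    (C' : Matrix (Fin p) (Fin n') ℝ) (D' : Matrix (Fin p) (Fin m) ℝ)
    (hS' : StablePair E' A')
    (hopt : ∫⁻ ω : ℝ, ENNReal.ofReal (frobSq
        (transfer Ep Ap Bp Cp D (iax ω) + transfer Em Am Bm Cm 0 (iax ω) -
          transfer E' A' B' C' D' (iax ω))) =
      ∫⁻ ω : ℝ, ENNReal.ofReal (frobSq (transfer Em Am Bm Cm 0 (iax ω)))) :
    ∀ ω : ℝ, transfer E' A' B' C' D' (iax ω) = transfer Ep Ap Bp Cp D (iax ω) := by
  intro ω
  have hstab : ∀ ω, iax ω ∈ {s : ℂ | 0 ≤ s.re} := fun ω => (iax_re ω).ge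
  have hanti : ∀ ω, iax ω ∈ {s : ℂ | s.re ≤ 0} := fun ω => (iax_re ω).le
  have h0 := eq_zero_of_lintegral_frobSq_add_eq
    (H := fun ω => transfer Ep Ap Bp Cp D (iax ω) - transfer E' A' B' C' D' (iax ω))
    (G := fun ω => transfer Em Am Bm Cm 0 (iax ω))
    (fun i j => (rationalOffPoles_transfer hstab Ep Ap Bp Cp D hp i j).sub hstab
      (rationalOffPoles_transfer hstab E' A' B' C' D' hS' i j))
    (fun i j => rationalOffPoles_transfer hanti Em Am Bm Cm 0 hm.2 i j)
    hfin (by simpa only [sub_add_eq_add_sub] using hopt) ω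
  exact (sub_eq_zero.mp h0).symm

end
end

section
/- Let S=(E,A,B,C,D) be an antistable system of order n with Gramians X_c, X_o and largest Hankel singular value σ₁, and let γ ≥ σ₁. If the pair (E_γ, A_γ) is regular, then sE_γ − A_γ is invertible for every s ∈ ℂ with Re s ≥ 0; i.e. the system (E_γ, A_γ, B_γ, C_γ, D) is stable. Moreover, if γ > σ₁, then (E_γ, A_γ) is regular (indeed E_γ is invertible). -/
open Matrix

section

open Filter Topology ComplexOrder MatrixOrder

theorem tendsto_pow_zero_of_forall_spectrum_lt {R : Type*} [NormedRing R] [NormedAlgebra ℂ R]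
    [CompleteSpace R] {a : R} (ha : ∀ z ∈ spectrum ℂ a, ‖z‖ < 1) :
    Tendsto (fun k : ℕ => a ^ k) atTop (𝓝 0) := by
  rcases subsingleton_or_nontrivial R with _ | _
  · exact tendsto_const_nhds.congr fun _ => Subsingleton.elim _ _
  have hr : spectralRadius ℂ a < (1 : NNReal) :=
    spectrum.spectralRadius_lt_of_forall_lt a fun z hz => by exact_mod_cast ha z hz
  obtain ⟨q, hq, hq1⟩ := ENNReal.lt_iff_exists_nnreal_btwn.mp hr
  have hq1' : q < 1 := by exact_mod_cast hq1
  have hev := (spectrum.pow_nnnorm_pow_one_div_tendsto_nhds_spectralRadius a).eventually_lt_const hq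
  refine squeeze_zero_norm' ?_ (tendsto_pow_atTop_nhds_zero_of_lt_one q.2 (by exact_mod_cast hq1'))
  filter_upwards [hev, eventually_gt_atTop 0] with k hk hk0
  have h := ENNReal.rpow_lt_rpow hk (show (0 : ℝ) < k by exact_mod_cast hk0)
  rw [← ENNReal.rpow_mul, one_div, inv_mul_cancel₀ (by positivity), ENNReal.rpow_one,
    ENNReal.rpow_natCast] at h
  exact_mod_cast h.le

variable {n m p : Type*} [Fintype n] [DecidableEq n] [Fintype m] [Fintype p]

theorem Matrix.tendsto_pow_zero_of_forall_spectrum_lt {T : Matrix n n ℂ}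
    (hT : ∀ z ∈ spectrum ℂ T, ‖z‖ < 1) : Tendsto (fun k : ℕ => T ^ k) atTop (𝓝 0) := by
  let _ : NormedRing (Matrix n n ℂ) := Matrix.linftyOpNormedRing
  let _ : NormedAlgebra ℂ (Matrix n n ℂ) := Matrix.linftyOpNormedAlgebra
  exact _root_.tendsto_pow_zero_of_forall_spectrum_lt hT

/-- A Hermitian solution of a Stein inequality with Schur stable coefficient is positive
semidefinite. -/
theorem posSemidef_of_stein {P T : Matrix n n ℂ} (hP : P.IsHermitian)
    (hT : ∀ z ∈ spectrum ℂ T, ‖z‖ < 1) (h : (P - T * P * Tᴴ).PosSemidef) : P.PosSemidef := by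
  have hk (k : ℕ) : (P - T ^ k * P * (T ^ k)ᴴ).PosSemidef := by
    induction k with
    | zero => simpa using Matrix.PosSemidef.zero
    | succ k ih =>
      convert ih.add (h.mul_mul_conjTranspose_same (T ^ k)) using 1
      simp only [pow_succ, conjTranspose_mul]
      noncomm_ring
  have hlim : Tendsto (fun k : ℕ => P - T ^ k * P * (T ^ k)ᴴ) atTop (𝓝 P) := by
    have hpow := Matrix.tendsto_pow_zero_of_forall_spectrum_lt hT
    have hc : Continuous fun S : Matrix n n ℂ => P - S * P * Sᴴ := by fun_prop
    have h0 := (hc.tendsto 0).comp hpow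
    simpa only [zero_mul, sub_zero, Function.comp_def] using h0
  refine .of_dotProduct_mulVec_nonneg hP fun x => ?_
  have hc : Continuous fun S : Matrix n n ℂ => star x ⬝ᵥ (S *ᵥ x) := by fun_prop
  exact ge_of_tendsto' ((hc.tendsto P).comp hlim) fun k => (hk k).dotProduct_mulVec_nonneg x

/-- The controllability Gramian of an antistable system is negative semidefinite. -/
theorem posSemidef_neg_of_lyapunov {E A X : Matrix n n ℂ} {B : Matrix n m ℂ}
    (hE : IsUnit E) (hA : ∀ s : ℂ, s.re ≤ 0 → IsUnit (s • E - A)) (hX : X.IsHermitian)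
    (h : A * X * Eᴴ + E * X * Aᴴ + B * Bᴴ = 0) : (-X).PosSemidef := by
  obtain ⟨U, hU⟩ : IsUnit (A + E) := by
    convert (hA (-1) (by simp)).neg using 1
    simp
  obtain ⟨V, hVu, hUi⟩ : ∃ V : Matrix n n ℂ, IsUnit V ∧ V * (A + E) = 1 :=
    ⟨↑U⁻¹, U⁻¹.isUnit, by rw [← hU, Units.inv_mul]⟩
  refine posSemidef_of_stein (T := V * (A - E)) hX.neg (fun z hz => ?_) ?_
  · by_contra! hz1
    refine spectrum.mem_iff.mp hz ?_
    have hz2 : z • (A + E) - (A - E) = (z - 1) • A + (z + 1) • E := by module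
    have : algebraMap ℂ (Matrix n n ℂ) z - V * (A - E) = V * (z • (A + E) - (A - E)) := by
      rw [mul_sub V (z • _), mul_smul_comm, hUi, Algebra.algebraMap_eq_smul_one]
    rw [this, hz2]
    refine hVu.mul ?_
    by_cases h1 : z = 1
    · subst h1
      have := hE.smul (Units.mk0 (2 : ℂ) two_ne_zero)
      convert this using 1
      simp [Units.smul_def]; norm_num
    · have h1' : 1 - z ≠ 0 := sub_ne_zero.mpr (Ne.symm h1)
      have hs : ((1 + z) / (1 - z)).re ≤ 0 := by
        rw [Complex.div_re, ← add_div]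
        refine div_nonpos_of_nonpos_of_nonneg ?_ (Complex.normSq_nonneg _)
        have : 1 ≤ z.re * z.re + z.im * z.im := by
          rw [← Complex.normSq_apply, Complex.normSq_eq_norm_sq]; nlinarith
        simp
        linarith
      convert (hA _ hs).smul (Units.mk0 _ h1') using 1
      simp only [Units.smul_def, Units.val_mk0, smul_sub, smul_smul, mul_div_cancel₀ _ h1']
      module
  · have hB : A * X * Eᴴ + E * X * Aᴴ = -(B * Bᴴ) := eq_neg_of_add_eq_zero_left h
    have key : (A + E) * X * (A + E)ᴴ - (A - E) * X * (A - E)ᴴ = -((2 : ℂ) • (B * Bᴴ)) := by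
      rw [← smul_neg, ← hB]
      simp only [conjTranspose_add, conjTranspose_sub, two_smul]
      noncomm_ring
    have hX' : X = V * ((A + E) * X * (A + E)ᴴ) * Vᴴ := by
      have : (V * (A + E)) * X * (V * (A + E))ᴴ = X := by simp [hUi]
      rw [conjTranspose_mul] at this
      simpa only [mul_assoc] using this.symm
    have h2 : ((2 : ℂ) • (B * Bᴴ)).PosSemidef :=
      (posSemidef_self_mul_conjTranspose B).smul (by norm_num)
    convert h2.mul_mul_conjTranspose_same V using 1
    rw [← neg_neg ((2 : ℂ) • (B * Bᴴ)), ← key]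
    conv_lhs => enter [1]; rw [hX']
    simp only [conjTranspose_mul]
    noncomm_ring

/-- If `P` is positive semidefinite and the spectrum of `P * Q` has real part at most `c`,
then `P * Q * P ≤ c • P`. -/
theorem posSemidef_smul_sub_mul_mul {P Q : Matrix n n ℂ} (hP : P.PosSemidef)
    (hQ : Q.IsHermitian) {c : ℝ} (hc : 0 ≤ c) (h : ∀ z ∈ spectrum ℂ (P * Q), z.re ≤ c) :
    ((c : ℂ) • P - P * Q * P).PosSemidef := by
  obtain ⟨L, rfl⟩ := CStarAlgebra.nonneg_iff_eq_star_mul_self.mp hP.nonneg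
  rw [star_eq_conjTranspose] at h ⊢
  have hH : (L * Q * Lᴴ).IsHermitian := isHermitian_mul_mul_conjTranspose L hQ
  have hcH : ((c : ℂ) • (1 : Matrix n n ℂ)).IsHermitian := by
    simp [IsHermitian, conjTranspose_smul]
  have hM : ((c : ℂ) • 1 - L * Q * Lᴴ).PosSemidef := by
    rw [(hcH.sub hH).posSemidef_iff_eigenvalues_nonneg]
    intro i
    set t := (hcH.sub hH).eigenvalues i
    have hmem : (t : ℂ) ∈ spectrum ℂ ((c : ℂ) • 1 - L * Q * Lᴴ) := by
      rw [(hcH.sub hH).spectrum_eq_image_range]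
      exact ⟨t, ⟨i, rfl⟩, rfl⟩
    have hct : (c : ℂ) - t ∈ spectrum ℂ (L * Q * Lᴴ) := by
      rw [← Algebra.algebraMap_eq_smul_one, ← spectrum.singleton_sub_eq,
        Set.singleton_sub] at hmem
      obtain ⟨w, hw, hwt⟩ := hmem
      rwa [← hwt, sub_sub_cancel]
    by_contra! hneg
    rw [Pi.zero_apply] at hneg
    have hlt : c < ((c : ℂ) - t).re := by
      rw [Complex.sub_re, Complex.ofReal_re, Complex.ofReal_re]; linarith
    have hne : (c : ℂ) - t ≠ 0 := fun h0 => by simp [h0] at hlt; linarith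
    refine hlt.not_ge (h _ ?_)
    have hmem' : (c : ℂ) - t ∈ spectrum ℂ (L * Q * Lᴴ) \ {0} := ⟨hct, hne⟩
    rw [spectrum.nonzero_mul_comm, ← mul_assoc] at hmem'
    exact hmem'.1
  convert hM.conjTranspose_mul_mul_same L using 1
  simp only [mul_sub, sub_mul, mul_smul_comm, smul_mul_assoc, mul_one, ← mul_assoc]

/-- A kernel vector of the pencil `s E_γ - A_γ` with `s` in the closed right half plane is
annihilated by both `R_γ` and `C_γ`. -/
theorem mulVec_eq_zero_of_pencil {E A Xc Xo : Matrix n n ℂ} {B : Matrix n m ℂ} {C : Matrix p n ℂ}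
    (hA : ∀ s : ℂ, s.re ≤ 0 → IsUnit (s • E - A))
    (hXc : Xc.IsHermitian) (hXo : Xo.IsHermitian)
    (hc : A * Xc * Eᴴ + E * Xc * Aᴴ + B * Bᴴ = 0)
    (ho : Aᴴ * Xo * E + Eᴴ * Xo * A + Cᴴ * C = 0)
    {c : ℝ} (hc0 : 0 ≤ c)
    (hZ : ((c : ℂ) • (-Xc) - (-Xc) * (-(Eᴴ * Xo * E)) * (-Xc)).PosSemidef)
    {R : Matrix n n ℂ} (hR : R = Xo * E * Xc * Eᴴ - (c : ℂ) • 1)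
    {s : ℂ} (hs : 0 ≤ s.re) {v : n → ℂ}
    (hv : (s • (Eᴴ * R) - (-(Aᴴ * R) - Cᴴ * (C * Xc * Eᴴ))) *ᵥ v = 0) :
    R *ᵥ v = 0 ∧ (C * Xc * Eᴴ) *ᵥ v = 0 := by
  set K := s • (Eᴴ * R) - (-(Aᴴ * R) - Cᴴ * (C * Xc * Eᴴ)) with hK
  set Y := C * Xc * Eᴴ with hY
  set Z := (c : ℂ) • (-Xc) - (-Xc) * (-(Eᴴ * Xo * E)) * (-Xc) with hZdef
  have hC : Cᴴ * C = -(Aᴴ * Xo * E) - Eᴴ * Xo * A := by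
    rw [eq_comm, ← sub_eq_zero, ← neg_eq_zero, ← ho]; abel
  have hB : B * Bᴴ = -(A * Xc * Eᴴ) - E * Xc * Aᴴ := by
    rw [eq_comm, ← sub_eq_zero, ← neg_eq_zero, ← hc]; abel
  have hK1 : E * Xc * K = s • (E * Z * Eᴴ) - (c : ℂ) • (E * Xc * Aᴴ)
      - E * Xc * Eᴴ * Xo * A * Xc * Eᴴ := by
    have : Cᴴ * Y = (Cᴴ * C) * Xc * Eᴴ := by simp only [hY, Matrix.mul_assoc]
    rw [hK, this, hC, hR, hZdef]
    simp only [mul_sub, sub_mul, mul_neg, neg_mul, mul_smul_comm, smul_mul_assoc, smul_sub,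
      smul_neg, mul_one, neg_neg, sub_neg_eq_add, mul_add, add_mul, smul_add, ← mul_assoc]
    abel
  have hsum : E * Xc * K + (E * Xc * K)ᴴ
      = ((2 * s.re : ℝ) : ℂ) • (E * Z * Eᴴ) + (c : ℂ) • (B * Bᴴ) + Yᴴ * Y := by
    have hYY : Yᴴ * Y = E * Xc * (Cᴴ * C) * Xc * Eᴴ := by
      simp only [hY, conjTranspose_mul, hXc.eq, conjTranspose_conjTranspose, Matrix.mul_assoc]
    have hZH : (E * Z * Eᴴ)ᴴ = E * Z * Eᴴ := (hZ.mul_mul_conjTranspose_same E).isHermitian.eq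
    have hs2 : ((2 * s.re : ℝ) : ℂ) = s + star s := by
      rw [← Complex.add_conj]; rfl
    rw [hK1, hYY, hC, hB, hs2]
    simp only [conjTranspose_sub, conjTranspose_smul, hZH]
    simp only [conjTranspose_mul, hXc.eq, hXo.eq, conjTranspose_conjTranspose,
      Complex.star_def, Complex.conj_ofReal, mul_sub, sub_mul, mul_neg, neg_mul, smul_sub,
      smul_neg, add_smul, ← mul_assoc]
    abel
  have hPS1 : (((2 * s.re : ℝ) : ℂ) • (E * Z * Eᴴ)).PosSemidef :=
    (hZ.mul_mul_conjTranspose_same E).smul (by exact_mod_cast (by positivity : 0 ≤ 2 * s.re))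
  have hPS2 : ((c : ℂ) • (B * Bᴴ)).PosSemidef :=
    (posSemidef_self_mul_conjTranspose B).smul (by exact_mod_cast hc0)
  have hzero : star v ⬝ᵥ ((E * Xc * K + (E * Xc * K)ᴴ) *ᵥ v) = 0 := by
    rw [add_mulVec, ← mulVec_mulVec, hv, mulVec_zero, zero_add, dotProduct_mulVec,
      ← star_mulVec, ← mulVec_mulVec, hv, mulVec_zero, star_zero, zero_dotProduct]
  have hYv : Y *ᵥ v = 0 := by
    have h12 := (hPS1.add hPS2).dotProduct_mulVec_nonneg v
    have h3 := (posSemidef_conjTranspose_mul_self Y).dotProduct_mulVec_nonneg v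
    rw [hsum, add_mulVec, dotProduct_add] at hzero
    have h4 := (add_eq_zero_iff_of_nonneg h12 h3).mp hzero |>.2
    rwa [← mulVec_mulVec, dotProduct_mulVec, ← star_mulVec, dotProduct_star_self_eq_zero] at h4
  refine ⟨?_, hYv⟩
  have hKv : (s • Eᴴ + Aᴴ) *ᵥ (R *ᵥ v) = 0 := by
    have : K = (s • Eᴴ + Aᴴ) * R + Cᴴ * Y := by
      rw [hK, add_mul, Matrix.smul_mul]; abel
    rwa [this, add_mulVec, ← mulVec_mulVec, ← mulVec_mulVec, hYv, mulVec_zero, add_zero] at hv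
  have hu : IsUnit (s • Eᴴ + Aᴴ) := by
    convert ((hA (-star s) (by simpa using hs)).star).neg using 1
    simp [star_eq_conjTranspose]
    abel
  exact (mulVec_injective_iff_isUnit.mpr hu) (by simpa using hKv)

theorem cplx_mul {ι κ l : Type*} [Fintype κ] (M : Matrix ι κ ℝ) (N : Matrix κ l ℝ) :
    cplx (M * N) = cplx M * cplx N :=
  Matrix.map_mul (f := Complex.ofRealHom)

theorem cplx_add {ι κ : Type*} (M N : Matrix ι κ ℝ) : cplx (M + N) = cplx M + cplx N := by
  ext; simp [cplx]

theorem cplx_sub {ι κ : Type*} (M N : Matrix ι κ ℝ) : cplx (M - N) = cplx M - cplx N := by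
  ext; simp [cplx]

theorem cplx_neg {ι κ : Type*} (M : Matrix ι κ ℝ) : cplx (-M) = -cplx M := by
  ext; simp [cplx]

theorem cplx_zero {ι κ : Type*} : cplx (0 : Matrix ι κ ℝ) = 0 := by
  ext; simp [cplx]

theorem cplx_smul {ι κ : Type*} (c : ℝ) (M : Matrix ι κ ℝ) :
    cplx (c • M) = (c : ℂ) • cplx M := by
  ext; simp [cplx]

theorem cplx_one {ι : Type*} [DecidableEq ι] : cplx (1 : Matrix ι ι ℝ) = 1 := by
  ext i j; by_cases h : i = j <;> simp [cplx, Matrix.one_apply, h]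

theorem cplx_transpose {ι κ : Type*} (M : Matrix ι κ ℝ) : cplx Mᵀ = (cplx M)ᴴ := by
  ext; simp [cplx]

theorem isUnit_cplx_iff {M : Matrix n n ℝ} : IsUnit (cplx M) ↔ IsUnit M := by
  have h : (cplx M).det = (M.det : ℂ) := (RingHom.map_det Complex.ofRealHom M).symm
  simp [Matrix.isUnit_iff_isUnit_det, h]

theorem Matrix.IsSymm.isHermitian_cplx {ι : Type*} {M : Matrix ι ι ℝ} (h : M.IsSymm) :
    (cplx M).IsHermitian := by
  rw [IsHermitian, ← cplx_transpose, h.eq]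

theorem cplx_Rg (E Xc Xo : Matrix n n ℝ) (γ : ℝ) :
    cplx (Rg E Xc Xo γ) =
      cplx Xo * cplx E * cplx Xc * (cplx E)ᴴ - ((γ ^ 2 : ℝ) : ℂ) • 1 := by
  simp only [Rg, cplx_sub, cplx_mul, cplx_smul, cplx_one, cplx_transpose]

theorem AntistablePair.mulVec_eq_zero {E A Xc Xo : Matrix n n ℝ} {B : Matrix n m ℝ}
    {C : Matrix p n ℝ} (hanti : AntistablePair E A) (hX : IsGramians E A B C Xc Xo)
    {σ1 γ : ℝ} (hσ : IsLargestHSV E Xc Xo σ1) (hγ : σ1 ≤ γ) {s : ℂ} (hs : 0 ≤ s.re) {v : n → ℂ}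
    (hv : (s • cplx (Eg E Xc Xo γ) - cplx (Ag E A C Xc Xo γ)) *ᵥ v = 0) :
    cplx (Rg E Xc Xo γ) *ᵥ v = 0 ∧ cplx (Cg C E Xc) *ᵥ v = 0 := by
  obtain ⟨hXc, hXo, hc, ho⟩ := hX
  have hc' := congrArg cplx hc
  have ho' := congrArg cplx ho
  simp only [cplx_add, cplx_mul, cplx_transpose, cplx_zero] at hc' ho'
  have hCg : cplx (Cg C E Xc) = cplx C * cplx Xc * (cplx E)ᴴ := by
    simp only [Cg, cplx_mul, cplx_transpose]
  have hP := posSemidef_neg_of_lyapunov (isUnit_cplx_iff.mpr hanti.1) hanti.2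
    hXc.isHermitian_cplx hc'
  have hQ : (-((cplx E)ᴴ * cplx Xo * cplx E)).IsHermitian :=
    (isHermitian_conjTranspose_mul_mul _ hXo.isHermitian_cplx).neg
  have hZ := posSemidef_smul_sub_mul_mul hP hQ (sq_nonneg γ) fun z hz => by
    refine (hσ.2.2 z ?_).trans (pow_le_pow_left₀ hσ.1 hγ 2)
    simpa only [neg_mul_neg, cplx_mul, cplx_transpose, mul_assoc] using hz
  rw [hCg]
  refine mulVec_eq_zero_of_pencil hanti.2 hXc.isHermitian_cplx hXo.isHermitian_cplx hc' ho'
    (sq_nonneg γ) hZ (cplx_Rg E Xc Xo γ) hs ?_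
  simpa only [Eg, Ag, cplx_mul, cplx_sub, cplx_neg, cplx_transpose, hCg] using hv

theorem IsLargestHSV.isUnit_Rg {E Xc Xo : Matrix n n ℝ} {σ1 γ : ℝ}
    (hσ : IsLargestHSV E Xc Xo σ1) (hγ : σ1 < γ) : IsUnit (Rg E Xc Xo γ) := by
  have hlt : σ1 ^ 2 < γ ^ 2 := pow_lt_pow_left₀ hγ hσ.1 two_ne_zero
  have hγ0 : ((γ ^ 2 : ℝ) : ℂ) ≠ 0 := by exact_mod_cast ((sq_nonneg σ1).trans_lt hlt).ne'
  rw [← isUnit_cplx_iff, cplx_Rg, ← IsUnit.neg_iff, neg_sub, ← Algebra.algebraMap_eq_smul_one]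
  by_contra hu
  have hmem : ((γ ^ 2 : ℝ) : ℂ) ∈
      spectrum ℂ (cplx Xo * cplx E * (cplx Xc * (cplx E)ᴴ)) \ {0} :=
    ⟨spectrum.mem_iff.mpr (by rwa [← mul_assoc]), hγ0⟩
  rw [spectrum.nonzero_mul_comm] at hmem
  have := hσ.2.2 ((γ ^ 2 : ℝ) : ℂ)
    (by simpa only [cplx_mul, cplx_transpose, mul_assoc] using hmem.1)
  rw [Complex.ofReal_re] at this
  exact hlt.not_ge this

end

noncomputable section

theorem stmt9 {n m p : ℕ}
    (E A : Matrix (Fin n) (Fin n) ℝ) (B : Matrix (Fin n) (Fin m) ℝ)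
    (C : Matrix (Fin p) (Fin n) ℝ) (D : Matrix (Fin p) (Fin m) ℝ)
    (hanti : AntistablePair E A)
    (Xc Xo : Matrix (Fin n) (Fin n) ℝ) (hX : IsGramians E A B C Xc Xo)
    (σ1 : ℝ) (hσ : IsLargestHSV E Xc Xo σ1)
    (γ : ℝ) (hγ : σ1 ≤ γ) :
    (RegularPair (Eg E Xc Xo γ) (Ag E A C Xc Xo γ) →
      StablePair (Eg E Xc Xo γ) (Ag E A C Xc Xo γ)) ∧
    (σ1 < γ → IsUnit (Eg E Xc Xo γ) ∧
      RegularPair (Eg E Xc Xo γ) (Ag E A C Xc Xo γ)) := by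
  refine ⟨fun ⟨z, hz⟩ s hs => ?_, fun hlt => ?_⟩
  · rw [Matrix.isUnit_iff_isUnit_det, isUnit_iff_ne_zero]
    intro hdet
    obtain ⟨v, hv0, hv⟩ := exists_mulVec_eq_zero_iff.mpr hdet
    obtain ⟨hR, hC⟩ := hanti.mulVec_eq_zero hX hσ hγ hs hv
    refine hz (exists_mulVec_eq_zero_iff.mp ⟨v, hv0, ?_⟩)
    simp only [Eg, Ag, cplx_mul, cplx_sub, cplx_neg, sub_mulVec, smul_mulVec, neg_mulVec,
      ← mulVec_mulVec, hR, hC, mulVec_zero, smul_zero, neg_zero, sub_zero]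
  · have hR := hσ.isUnit_Rg hlt
    have hEt : IsUnit Eᵀ := (isUnit_transpose E).mpr hanti.1
    refine ⟨hEt.mul hR, 0, fun hdet => ?_⟩
    obtain ⟨v, hv0, hv⟩ := exists_mulVec_eq_zero_iff.mpr hdet
    have hRv := (hanti.mulVec_eq_zero hX hσ hγ (by simp) hv).1
    exact hv0 (mulVec_injective_iff_isUnit.mpr (isUnit_cplx_iff.mpr hR) (by simpa using hRv))

end
end
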